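/- arXiv:math/0601752 — 3 statements merged into one kernel-verified Lean document; each statement's English description precedes it below -/
import Mathlib

section
/- Let U ⊆ ℝ^m be an open set, ψ : U → ℝ a smooth function such that dψ_x ≠ 0 for every x with ψ(x) = 0, and Z = ψ⁻¹(0). Let w₁,…,w_k : U → ℂ^k be smooth maps such that (w₁(x),…,w_k(x)) is a ℂ-basis of ℂ^k for every x ∈ U, and let S ⊆ {1,…,k}. Let ℰ be the set of smooth maps f : U → ℂ^k such that for every x ∈ Z, f(x) lies in the ℂ-span of {w_i(x) : i ∈ S}. Then ℰ is a free module over the ring C^∞(U,ℂ) with basis {w_i : i ∈ S} ∪ {ψ·w_i : i ∉ S}; that is, the C^∞(U,ℂ)-linear map C^∞(U,ℂ)^k → ℰ sending (g₁,…,g_k) to Σ_{i∈S} g_i w_i + Σ_{i∉S} g_i ψ w_i is well defined and bijective. -/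
open Set Filter Topology MeasureTheory
open scoped ContDiff

universe u

/-- An integral over a compact interval depends smoothly on parameters on which the integrand
depends smoothly. -/
theorem contDiff_nat_intervalIntegral {E V : Type u} [NormedAddCommGroup E] [NormedSpace ℝ E]
    [FiniteDimensional ℝ E] [NormedAddCommGroup V] [NormedSpace ℝ V]
    (n : ℕ) {F : E → ℝ → V} (hF : ContDiff ℝ ∞ (Function.uncurry F)) (a b : ℝ) :
    ContDiff ℝ n fun x => ∫ t in a..b, F x t := by
  induction n generalizing V with
  | zero =>
    exact contDiff_zero.2
      (intervalIntegral.continuous_parametric_intervalIntegral_of_continuous' hF.continuous a b)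
  | succ n ih =>
    have hF' : ContDiff ℝ ∞ (Function.uncurry fun x t => fderiv ℝ (fun y => F y t) x) := by
      have h : ContDiff ℝ ∞ (Function.uncurry fun (p : E × ℝ) (y : E) => F y p.2) :=
        hF.comp (contDiff_snd.prodMk (contDiff_snd.comp contDiff_fst))
      exact ContDiff.fderiv (n := ∞) h contDiff_fst (by simp)
    refine contDiff_succ_iff_hasFDerivAt.2 ⟨_, ih hF', fun x => ?_⟩
    obtain ⟨C, hC⟩ := ((isCompact_closedBall x 1).prod
      (isCompact_uIcc (a := a) (b := b))).bddAbove_image hF'.continuous.norm.continuousOn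
    have hsec (y : E) : Continuous (F y) :=
      hF.continuous.comp (Continuous.prodMk_right y)
    have hsec' : Continuous fun t => fderiv ℝ (fun y => F y t) x :=
      hF'.continuous.comp (Continuous.prodMk_right x)
    refine intervalIntegral.hasFDerivAt_integral_of_dominated_of_fderiv_le
      (F' := fun x t => fderiv ℝ (fun y => F y t) x) (bound := fun _ => C)
      (Metric.closedBall_mem_nhds x one_pos)
      (.of_forall fun y => (hsec y).aestronglyMeasurable)
      ((hsec x).intervalIntegrable _ _) hsec'.aestronglyMeasurable ?_
      intervalIntegrable_const ?_
    · exact .of_forall fun t ht y hy =>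
        hC ⟨(y, t), ⟨hy, uIoc_subset_uIcc ht⟩, rfl⟩
    · refine .of_forall fun t _ y _ => DifferentiableAt.hasFDerivAt ?_
      exact ((hF.comp (contDiff_prodMk_left t)).differentiable (by simp)) y

/-- Hadamard's lemma: a smooth map vanishing on a hyperplane is divisible by the linear form
defining it. -/
theorem ContDiff.exists_eq_smul_of_ker {E V : Type u} [NormedAddCommGroup E] [NormedSpace ℝ E]
    [FiniteDimensional ℝ E] [NormedAddCommGroup V] [NormedSpace ℝ V] [CompleteSpace V]
    {f : E → V} (hf : ContDiff ℝ ∞ f) {l : E →L[ℝ] ℝ} (hl : l ≠ 0)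
    (hz : ∀ y, l y = 0 → f y = 0) :
    ∃ h : E → V, ContDiff ℝ ∞ h ∧ ∀ y, f y = l y • h y := by
  obtain ⟨v, hv⟩ : ∃ v, l v = 1 := by
    obtain ⟨u, hu⟩ := DFunLike.ne_iff.1 hl
    exact ⟨(l u)⁻¹ • u, by simpa using inv_mul_cancel₀ hu⟩
  have hf' : ContDiff ℝ ∞ (fderiv ℝ f) := hf.fderiv_right (by simp)
  refine ⟨fun y => ∫ t in (0 : ℝ)..1, fderiv ℝ f (y + (t - 1) • l y • v) v,
    contDiff_infty.2 fun n => contDiff_nat_intervalIntegral n ?_ 0 1, fun y => ?_⟩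
  · exact ContDiff.clm_apply (hf'.comp (by fun_prop)) contDiff_const
  · have hder (t : ℝ) : HasDerivAt (fun t : ℝ => f (y + (t - 1) • l y • v))
        (l y • fderiv ℝ f (y + (t - 1) • l y • v) v) t := by
      have h1 : HasDerivAt (fun t : ℝ => y + (t - 1) • l y • v) (l y • v) t := by
        simpa using (((hasDerivAt_id t).sub_const 1).smul_const (l y • v)).const_add y
      have h2 := (hf.differentiable (by simp) _).hasFDerivAt.comp_hasDerivAt t h1
      rwa [map_smul] at h2
    have hcont : Continuous fun t : ℝ => l y • fderiv ℝ f (y + (t - 1) • l y • v) v :=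
      ((hf'.continuous.comp (by fun_prop)).clm_apply continuous_const).const_smul _
    have h := intervalIntegral.integral_eq_sub_of_hasDerivAt (fun t _ => hder t)
      (hcont.intervalIntegrable 0 1)
    rw [intervalIntegral.integral_smul] at h
    rw [h, hz (y + (0 - 1) • l y • v) (by simp [hv])]
    simp

/-- A smooth map vanishing on the zero set of a smooth function is, near a point
where the differential of this function is nonzero, a smooth multiple of it. -/
theorem ContDiffOn.exists_eventually_eq_smul {E V : Type u} [NormedAddCommGroup E]
    [NormedSpace ℝ E] [FiniteDimensional ℝ E] [NormedAddCommGroup V] [NormedSpace ℝ V]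
    [CompleteSpace V] {U : Set E} (hU : IsOpen U) {ψ : E → ℝ} (hψ : ContDiffOn ℝ ∞ ψ U)
    {c : E → V} (hc : ContDiffOn ℝ ∞ c U) (hz : ∀ x ∈ U, ψ x = 0 → c x = 0)
    {p : E} (hp : p ∈ U) (hreg : fderiv ℝ ψ p ≠ 0) :
    ∃ h : E → V, ContDiffOn ℝ ∞ h U ∧ ∀ᶠ x in 𝓝 p, c x = ψ x • h x := by
  have : CompleteSpace E := FiniteDimensional.complete ℝ E
  set l := fderiv ℝ ψ p with hl
  obtain ⟨v, hv⟩ : ∃ v, l v = 1 := by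
    obtain ⟨u, hu⟩ := DFunLike.ne_iff.1 hreg
    exact ⟨(l u)⁻¹ • u, by simpa using inv_mul_cancel₀ hu⟩
  -- `Φ` is a local diffeomorphism at `p` that straightens `ψ` into `l`.
  let Φ : E → E := fun x => x + (ψ x - l x) • v
  have hlΦ (x : E) : l (Φ x) = ψ x := by simp [Φ, hv]
  have hΦ : ContDiffOn ℝ ∞ Φ U :=
    contDiffOn_id.add ((hψ.sub l.contDiff.contDiffOn).smul contDiffOn_const)
  have hΦat {x : E} (hx : x ∈ U) : ContDiffAt ℝ ∞ Φ x := hΦ.contDiffAt (hU.mem_nhds hx)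
  have hΦp : HasFDerivAt Φ (ContinuousLinearEquiv.refl ℝ E : E →L[ℝ] E) p := by
    have hd : HasFDerivAt ψ l p :=
      ((hψ.contDiffAt (hU.mem_nhds hp)).differentiableAt (by simp)).hasFDerivAt
    have := (hasFDerivAt_id p).add ((hd.sub l.hasFDerivAt).smul_const v)
    refine this.congr_fderiv ?_
    ext; simp
  let e := (hΦat hp).toOpenPartialHomeomorph Φ hΦp (by simp)
  have he (x : E) : e x = Φ x := rfl
  have hpe : p ∈ e.source := (hΦat hp).mem_toOpenPartialHomeomorph_source hΦp (by simp)
  have hinv : ∀ᶠ x in 𝓝 p, x ∈ U ∧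
      fderiv ℝ Φ x ∈ range ((↑) : (E ≃L[ℝ] E) → E →L[ℝ] E) := by
    refine (hU.mem_nhds hp |> eventually_mem_set.2).and ?_
    have hcont : ContinuousAt (fderiv ℝ Φ) p :=
      ((hΦat hp).fderiv_right (m := 0) (by simp)).continuousAt
    refine hcont.eventually_mem ?_
    rw [hΦp.fderiv]
    exact ContinuousLinearEquiv.nhds _
  have hW : ∀ᶠ y in 𝓝 (Φ p), y ∈ e.target ∧ e.symm y ∈ U ∧
      fderiv ℝ Φ (e.symm y) ∈ range ((↑) : (E ≃L[ℝ] E) → E →L[ℝ] E) := by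
    refine (e.open_target.mem_nhds (e.map_source hpe) |> eventually_mem_set.2).and ?_
    have := e.continuousAt_symm (e.map_source hpe)
    rw [ContinuousAt, e.left_inv hpe] at this
    exact this.eventually hinv
  obtain ⟨r, hr, hrW⟩ := Metric.nhds_basis_closedBall.eventually_iff.1 hW
  let χ : ContDiffBump (Φ p) := ⟨r / 2, r, half_pos hr, half_lt_self hr⟩
  have hχ (y : E) (hy : y ∈ tsupport χ) : y ∈ Metric.closedBall (Φ p) r := by
    rwa [χ.tsupport_eq] at hy
  have hsmooth : ContDiff ℝ ∞ fun y => χ y • c (e.symm y) := by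
    refine contDiff_iff_contDiffAt.2 fun y => ?_
    by_cases hy : y ∉ tsupport χ
    · refine (contDiffAt_const (c := 0)).congr_of_eventuallyEq ?_
      filter_upwards [notMem_tsupport_iff_eventuallyEq.1 hy] with z hz
      rw [hz, Pi.zero_apply, zero_smul]
    obtain ⟨hyt, hyU, A, hA⟩ := hrW (hχ y (not_not.1 hy))
    have hsymm : ContDiffAt ℝ ∞ e.symm y := by
      refine e.contDiffAt_symm (f₀' := A) hyt ?_ (hΦat hyU)
      rw [hA]
      exact ((hΦat hyU).differentiableAt (by simp)).hasFDerivAt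
    exact χ.contDiff.contDiffAt.smul
      ((hc.contDiffAt (hU.mem_nhds hyU)).comp y hsymm)
  obtain ⟨H, hH, hHeq⟩ := hsmooth.exists_eq_smul_of_ker hreg fun y hy => by
    by_cases hyχ : y ∈ tsupport χ
    · obtain ⟨hyt, hyU, -⟩ := hrW (hχ y hyχ)
      rw [hz _ hyU, smul_zero]
      rw [← hlΦ, ← he, e.right_inv hyt, hy]
    · rw [image_eq_zero_of_notMem_tsupport hyχ, zero_smul]
  refine ⟨H ∘ Φ, hH.comp_contDiffOn hΦ, ?_⟩
  filter_upwards [e.open_source.mem_nhds hpe,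
    (hΦat hp).continuousAt.eventually χ.eventuallyEq_one] with x hxs hx1
  have := hHeq (Φ x)
  rwa [hlΦ, hx1, Pi.one_apply, one_smul, ← he, e.left_inv hxs] at this

/-- The derivative of a product at a zero of its scalar factor. -/
theorem fderiv_eq_smulRight_of_eq_smul {E V : Type*} [NormedAddCommGroup E]
    [NormedSpace ℝ E] [NormedAddCommGroup V] [NormedSpace ℝ V] {ψ : E → ℝ} {c h : E → V} {p : E}
    (hψ : DifferentiableAt ℝ ψ p) (hh : DifferentiableAt ℝ h p) (hp0 : ψ p = 0)
    (heq : ∀ᶠ x in 𝓝 p, c x = ψ x • h x) :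
    fderiv ℝ c p = (fderiv ℝ ψ p).smulRight (h p) := by
  rw [EventuallyEq.fderiv_eq heq]
  refine (hψ.hasFDerivAt.fun_smul hh.hasFDerivAt).fderiv.trans ?_
  simp [hp0]

/-- The quotient by a function with regular zeros is unique at each point. -/
theorem eq_of_eventually_smul_eq_smul {E V : Type*} [NormedAddCommGroup E]
    [NormedSpace ℝ E] [NormedAddCommGroup V] [NormedSpace ℝ V] {ψ : E → ℝ} {g h : E → V} {p : E}
    (hψ : DifferentiableAt ℝ ψ p) (hg : DifferentiableAt ℝ g p) (hh : DifferentiableAt ℝ h p)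
    (hreg : ψ p = 0 → fderiv ℝ ψ p ≠ 0) (heq : ∀ᶠ x in 𝓝 p, ψ x • g x = ψ x • h x) :
    g p = h p := by
  by_cases hp0 : ψ p = 0
  · have h1 := fderiv_eq_smulRight_of_eq_smul hψ hg hp0 (.of_forall fun _ => rfl)
    have h2 := fderiv_eq_smulRight_of_eq_smul hψ hh hp0 heq
    obtain ⟨v, hv⟩ := DFunLike.ne_iff.1 (hreg hp0)
    have h3 := DFunLike.congr_fun (h1.symm.trans h2) v
    exact smul_right_injective V hv h3
  · exact smul_right_injective V hp0 heq.self_of_nhds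

/-- A smooth map vanishing on the zero set of a smooth function all of whose zeros are regular
is a smooth multiple of this function. -/
theorem ContDiffOn.exists_eq_smul_of_regular {E V : Type u} [NormedAddCommGroup E]
    [NormedSpace ℝ E] [FiniteDimensional ℝ E] [NormedAddCommGroup V] [NormedSpace ℝ V]
    [CompleteSpace V] {U : Set E} (hU : IsOpen U) {ψ : E → ℝ} (hψ : ContDiffOn ℝ ∞ ψ U)
    (hreg : ∀ x ∈ U, ψ x = 0 → fderiv ℝ ψ x ≠ 0)
    {c : E → V} (hc : ContDiffOn ℝ ∞ c U) (hz : ∀ x ∈ U, ψ x = 0 → c x = 0) :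
    ∃ h : E → V, ContDiffOn ℝ ∞ h U ∧ ∀ x ∈ U, c x = ψ x • h x := by
  have hloc (p : E) (hp : p ∈ U) : ∃ h : E → V, ∀ᶠ x in 𝓝 p,
      x ∈ U ∧ ContDiffAt ℝ ∞ h x ∧ c x = ψ x • h x := by
    by_cases hp0 : ψ p = 0
    · obtain ⟨h, hh, heq⟩ := ContDiffOn.exists_eventually_eq_smul hU hψ hc hz hp (hreg p hp hp0)
      refine ⟨h, ?_⟩
      filter_upwards [hU.mem_nhds hp, heq] with x hx hxe
      exact ⟨hx, hh.contDiffAt (hU.mem_nhds hx), hxe⟩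
    · refine ⟨fun x => (ψ x)⁻¹ • c x, ?_⟩
      filter_upwards [hU.mem_nhds hp,
        (hψ.continuousOn.continuousAt (hU.mem_nhds hp)).eventually_ne hp0] with x hx hx0
      exact ⟨hx, ((hψ.contDiffAt (hU.mem_nhds hx)).inv hx0).smul (hc.contDiffAt (hU.mem_nhds hx)),
        (smul_inv_smul₀ hx0 _).symm⟩
  choose! q hq using hloc
  refine ⟨fun x => q x x, fun p hp => ContDiffAt.contDiffWithinAt ?_,
    fun x hx => (hq x hx).self_of_nhds.2.2⟩
  refine (hq p hp).self_of_nhds.2.1.congr_of_eventuallyEq ?_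
  filter_upwards [(hq p hp).eventually_nhds] with x hx
  have hxU := hx.self_of_nhds.1
  refine eq_of_eventually_smul_eq_smul
    ((hψ.contDiffAt (hU.mem_nhds hxU)).differentiableAt (by simp))
    ((hq x hxU).self_of_nhds.2.1.differentiableAt (by simp))
    (hx.self_of_nhds.2.1.differentiableAt (by simp)) (hreg x hxU) ?_
  filter_upwards [hx, hq x hxU] with y hy hy'
  rw [← hy.2.2, ← hy'.2.2]

/-- The coefficients of a smooth map with respect to a smooth frame are smooth. -/
theorem ContDiffOn.exists_frame_coeff {E : Type*} [NormedAddCommGroup E] [NormedSpace ℝ E]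
    {k : ℕ} {U : Set E} {w : Fin k → E → Fin k → ℂ} (hw : ∀ i, ContDiffOn ℝ ∞ (w i) U)
    (hli : ∀ x ∈ U, LinearIndependent ℂ fun i => w i x)
    {f : E → Fin k → ℂ} (hf : ContDiffOn ℝ ∞ f U) :
    ∃ a : Fin k → E → ℂ, (∀ i, ContDiffOn ℝ ∞ (a i) U) ∧
      ∀ x ∈ U, ∑ i, a i x • w i x = f x := by
  let M : E → Matrix (Fin k) (Fin k) ℂ := fun x => (Matrix.of fun i => w i x).transpose
  have hdet {N : E → Matrix (Fin k) (Fin k) ℂ}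
      (hN : ∀ i j, ContDiffOn ℝ ∞ (fun x => N x i j) U) : ContDiffOn ℝ ∞ (fun x => (N x).det) U := by
    simp only [Matrix.det_apply]
    exact ContDiffOn.sum fun σ _ => (contDiffOn_prod fun i _ => hN _ _).const_smul _
  have hM (i j) : ContDiffOn ℝ ∞ (fun x => M x i j) U := contDiffOn_pi.1 (hw j) i
  have hM0 (x) (hx : x ∈ U) : IsUnit (M x).det := by
    rw [Matrix.det_transpose, ← Matrix.isUnit_iff_isUnit_det]
    exact Matrix.linearIndependent_rows_iff_isUnit.1 (hli x hx)
  refine ⟨fun i x => ((M x).det)⁻¹ * (M x).cramer (f x) i, fun i => ?_, fun x hx => ?_⟩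
  · refine ((hdet hM).inv fun x hx => (hM0 x hx).ne_zero).mul ?_
    simp only [Matrix.cramer_apply]
    refine hdet fun a b => ?_
    simp only [Matrix.updateCol_apply]
    split_ifs
    · exact contDiffOn_pi.1 hf a
    · exact hM a b
  · have h := Matrix.mulVec_cramer (M x) (f x)
    ext j
    have hj := congrFun h j
    simp only [Matrix.mulVec, dotProduct, Pi.smul_apply, smul_eq_mul] at hj
    simp only [Finset.sum_apply, Pi.smul_apply, smul_eq_mul]
    rw [← mul_right_inj' (hM0 x hx).ne_zero, ← hj, Finset.mul_sum]
    refine Finset.sum_congr rfl fun i _ => ?_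
    rw [← mul_assoc, mul_inv_cancel_left₀ (hM0 x hx).ne_zero, mul_comm]
    rfl

/-- A linear combination of independent vectors lying in the span of a subfamily has
vanishing coefficients outside this subfamily. -/
theorem LinearIndependent.coeff_eq_zero_of_mem_span {ι R M : Type*} [Fintype ι] [Ring R]
    [AddCommGroup M] [Module R M] {w : ι → M} (hw : LinearIndependent R w) {S : Finset ι}
    {a : ι → R} (ha : ∑ i, a i • w i ∈ Submodule.span R {v | ∃ i ∈ S, v = w i})
    {i : ι} (hi : i ∉ S) : a i = 0 := by
  have hset : {v | ∃ i ∈ S, v = w i} = w '' S := by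
    ext v; simp [eq_comm]
  rw [hset, Finsupp.mem_span_image_iff_linearCombination] at ha
  obtain ⟨b, hb, hab⟩ := ha
  have h : Finsupp.equivFunOnFinite.symm a = b := hw (by
    rw [hab, Finsupp.linearCombination_apply, Finsupp.sum_fintype _ _ (by simp)]
    rfl)
  have hbi : b i = 0 := by
    by_contra h0
    exact hi (hb (Finsupp.mem_support_iff.2 h0))
  rw [← hbi, ← h]; rfl


/-- Local-coordinate form of the boundary Lie algebroid lemma: the smooth maps
`f : U → ℂ^k` whose values on `Z = ψ⁻¹(0)` lie in the span of the frame members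
indexed by `S` form a free module over `C^∞(U,ℂ)` with basis
`{w_i : i ∈ S} ∪ {ψ·w_i : i ∉ S}`. -/
theorem boundary_algebroid_locally_free (m k : ℕ) (U : Set (Fin m → ℝ)) (hU : IsOpen U)
    (ψ : (Fin m → ℝ) → ℝ) (hψ : ContDiffOn ℝ (⊤ : ℕ∞) ψ U)
    (hreg : ∀ x ∈ U, ψ x = 0 → fderiv ℝ ψ x ≠ 0)
    (Z : Set (Fin m → ℝ)) (hZ : Z = {x ∈ U | ψ x = 0})
    (w : Fin k → (Fin m → ℝ) → (Fin k → ℂ))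
    (hw : ∀ i, ContDiffOn ℝ (⊤ : ℕ∞) (w i) U)
    (hbasis : ∀ x ∈ U, LinearIndependent ℂ (fun i => w i x) ∧
      Submodule.span ℂ (Set.range fun i => w i x) = ⊤)
    (S : Finset (Fin k))
    (E : Set ((Fin m → ℝ) → (Fin k → ℂ)))
    (hE : E = {f | ContDiffOn ℝ (⊤ : ℕ∞) f U ∧ ∀ x ∈ Z,
      f x ∈ Submodule.span ℂ {v | ∃ i ∈ S, v = w i x}})
    (T : (Fin k → (Fin m → ℝ) → ℂ) → (Fin m → ℝ) → (Fin k → ℂ))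
    (hT : T = fun g x => (∑ i ∈ S, g i x • w i x) +
      ∑ i ∈ Sᶜ, ((ψ x : ℂ) * g i x) • w i x) :
    (∀ g : Fin k → (Fin m → ℝ) → ℂ, (∀ i, ContDiffOn ℝ (⊤ : ℕ∞) (g i) U) → T g ∈ E) ∧
    (∀ f ∈ E, ∃ g : Fin k → (Fin m → ℝ) → ℂ,
      (∀ i, ContDiffOn ℝ (⊤ : ℕ∞) (g i) U) ∧ Set.EqOn (T g) f U) ∧
    (∀ g g' : Fin k → (Fin m → ℝ) → ℂ, (∀ i, ContDiffOn ℝ (⊤ : ℕ∞) (g i) U) →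
      (∀ i, ContDiffOn ℝ (⊤ : ℕ∞) (g' i) U) → Set.EqOn (T g) (T g') U →
      ∀ i, Set.EqOn (g i) (g' i) U) := by
  have hTg (g : Fin k → (Fin m → ℝ) → ℂ) (x : Fin m → ℝ) :
      T g x = ∑ i, (if i ∈ S then g i x else ψ x • g i x) • w i x := by
    simp only [hT]
    rw [← Finset.sum_add_sum_compl S fun i => (if i ∈ S then g i x else ψ x • g i x) • w i x]
    congr 1 <;> refine Finset.sum_congr rfl fun i hi => ?_
    · rw [if_pos hi]
    · rw [if_neg (Finset.mem_compl.1 hi), Complex.real_smul]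
  have hψC : ContDiffOn ℝ (⊤ : ℕ∞) (fun x => (ψ x : ℂ)) U :=
    Complex.ofRealCLM.contDiff.comp_contDiffOn hψ
  subst hE hZ
  refine ⟨fun g hg => ⟨?_, ?_⟩, ?_, ?_⟩
  · rw [hT]
    exact (ContDiffOn.sum fun i _ => (hg i).smul (hw i)).add
      (ContDiffOn.sum fun i _ => (hψC.mul (hg i)).smul (hw i))
  · rintro x ⟨-, hx0⟩
    simp only [hT, hx0, Complex.ofReal_zero, zero_mul, zero_smul, Finset.sum_const_zero, add_zero]
    exact Submodule.sum_mem _ fun i hi =>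
      Submodule.smul_mem _ _ (Submodule.subset_span ⟨i, hi, rfl⟩)
  · rintro f ⟨hf, hfZ⟩
    obtain ⟨a, ha, haf⟩ := ContDiffOn.exists_frame_coeff hw (fun x hx => (hbasis x hx).1) hf
    have hdiv (i : Fin k) : ∃ h : (Fin m → ℝ) → ℂ, ContDiffOn ℝ (⊤ : ℕ∞) h U ∧
        ∀ x ∈ U, a i x = if i ∈ S then h x else ψ x • h x := by
      by_cases hi : i ∈ S
      · exact ⟨a i, ha i, fun x _ => by rw [if_pos hi]⟩
      · simp only [if_neg hi]
        refine ContDiffOn.exists_eq_smul_of_regular hU hψ hreg (ha i) fun x hx hx0 => ?_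
        refine (hbasis x hx).1.coeff_eq_zero_of_mem_span (a := fun i => a i x) ?_ hi
        rw [haf x hx]
        exact hfZ x ⟨hx, hx0⟩
    choose g hg hga using hdiv
    refine ⟨g, hg, fun x hx => ?_⟩
    rw [hTg, ← haf x hx]
    exact Finset.sum_congr rfl fun i _ => by rw [hga i x hx]
  · intro g g' hg hg' h i
    have hcoeff (x) (hx : x ∈ U) : (if i ∈ S then g i x else ψ x • g i x) =
        if i ∈ S then g' i x else ψ x • g' i x := by
      have hx' := h hx
      rw [hTg, hTg] at hx'
      exact congrFun ((hbasis x hx).1.fintypeLinearCombination_injective hx') i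
    intro x hx
    by_cases hi : i ∈ S
    · simpa [hi] using hcoeff x hx
    · simp only [if_neg hi] at hcoeff
      have hd {V : Type} [NormedAddCommGroup V] [NormedSpace ℝ V] {q : (Fin m → ℝ) → V}
          (hq : ContDiffOn ℝ (⊤ : ℕ∞) q U) : DifferentiableAt ℝ q x :=
        (hq.contDiffAt (hU.mem_nhds hx)).differentiableAt (by simp)
      exact eq_of_eventually_smul_eq_smul (hd hψ) (hd (hg i)) (hd (hg' i)) (hreg x hx)
        (eventually_of_mem (hU.mem_nhds hx) hcoeff)
end

section
/- Let f : ℝ² → ℂ be a smooth (C^∞) function satisfying i·∂f/∂t(x,t) − t·∂f/∂x(x,t) = 0 for all (x,t) ∈ ℝ². Then f is even in t: f(x,−t) = f(x,t) for all (x,t) ∈ ℝ². -/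
/-- A function that is differentiable on the lower half-plane, continuous on `ℂ` and vanishing on
the real axis vanishes on the lower half-plane: apply the maximum principle on a square centred at
`z₀` and touching the axis to the product of the four rotates of `h` about `z₀`. -/
theorem eq_zero_of_forall_im_eq_zero {h : ℂ → ℂ} (hc : Continuous h)
    (hd : ∀ z : ℂ, z.im < 0 → DifferentiableAt ℂ h z) (h0 : ∀ z : ℂ, z.im = 0 → h z = 0)
    {z₀ : ℂ} (hz₀ : z₀.im < 0) : h z₀ = 0 := by
  have hI (w : ℂ) : (Complex.I * w).im = w.re ∧ (-Complex.I * w).im = -w.re := by simp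
  set P : ℂ → ℂ := fun w =>
    h (z₀ + w) * h (z₀ - w) * (h (z₀ + Complex.I * w) * h (z₀ + -Complex.I * w)) with hP
  set D : Set ℂ := {w | |w.re| < -z₀.im ∧ |w.im| < -z₀.im} with hD
  have hDo : IsOpen D :=
    .and (isOpen_lt (by fun_prop) (by fun_prop)) (isOpen_lt (by fun_prop) (by fun_prop))
  have hDcl : closure D ⊆ {w | |w.re| ≤ -z₀.im ∧ |w.im| ≤ -z₀.im} :=
    closure_minimal (fun w hw => ⟨hw.1.le, hw.2.le⟩)
      (.and (isClosed_le (by fun_prop) (by fun_prop)) (isClosed_le (by fun_prop) (by fun_prop)))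
  have hDb : Bornology.IsBounded D := by
    refine (Metric.isBounded_closedBall (x := (0 : ℂ)) (r := -z₀.im + -z₀.im)).subset fun w hw => ?_
    rw [mem_closedBall_zero_iff]
    exact (Complex.norm_le_abs_re_add_abs_im w).trans (add_le_add hw.1.le hw.2.le)
  have hPd : DiffContOnCl ℂ P D := by
    refine ⟨fun w hw => DifferentiableAt.differentiableWithinAt ?_, Continuous.continuousOn ?_⟩
    · obtain ⟨hre, him⟩ := hw
      rw [abs_lt] at hre him
      have h1 : DifferentiableAt ℂ h (z₀ + w) := hd _ (by simp only [Complex.add_im]; linarith)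
      have h2 : DifferentiableAt ℂ h (z₀ - w) := hd _ (by simp only [Complex.sub_im]; linarith)
      have h3 : DifferentiableAt ℂ h (z₀ + Complex.I * w) :=
        hd _ (by rw [Complex.add_im, (hI w).1]; linarith)
      have h4 : DifferentiableAt ℂ h (z₀ + -Complex.I * w) :=
        hd _ (by rw [Complex.add_im, (hI w).2]; linarith)
      exact ((h1.comp w (by fun_prop)).mul (h2.comp w (by fun_prop))).mul
        ((h3.comp w (f := fun w => z₀ + Complex.I * w) (by fun_prop)).mul
          (h4.comp w (f := fun w => z₀ + -Complex.I * w) (by fun_prop)))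
    · fun_prop
  have hPfr : ∀ w ∈ frontier D, ‖P w‖ ≤ 0 := by
    intro w hw
    rw [hDo.frontier_eq] at hw
    obtain ⟨hre, him⟩ := hDcl hw.1
    have hor : |w.re| = -z₀.im ∨ |w.im| = -z₀.im := by
      by_contra! hne
      exact hw.2 ⟨lt_of_le_of_ne hre hne.1, lt_of_le_of_ne him hne.2⟩
    rw [norm_le_zero_iff]
    simp only [hP, mul_eq_zero]
    rcases hor with hor | hor <;> rcases abs_choice (α := ℝ) _ with ha | ha <;> rw [ha] at hor
    · exact .inr (.inl (h0 _ (by rw [Complex.add_im, (hI w).1]; linarith)))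
    · exact .inr (.inr (h0 _ (by rw [Complex.add_im, (hI w).2]; linarith)))
    · exact .inl (.inl (h0 _ (by rw [Complex.add_im]; linarith)))
    · exact .inl (.inr (h0 _ (by rw [Complex.sub_im]; linarith)))
  have hmem : (0 : ℂ) ∈ D := by simp [hD, hz₀]
  have hP0 := norm_le_zero_iff.1
    (Complex.norm_le_of_forall_mem_frontier_norm_le hDb hPd hPfr (subset_closure hmem))
  simpa [hP] using hP0

/-- On either side of the `x`-axis, an integral of the Mizohata structure is holomorphic as a
function of `ζ = x - i t² / 2`. -/
theorem differentiableAt_mizohata {f : ℝ × ℝ → ℂ} (hf : Differentiable ℝ f)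
    (hint : ∀ x t : ℝ,
      Complex.I * deriv (fun s => f (x, s)) t - (t : ℂ) * deriv (fun u => f (u, t)) x = 0)
    {σ : ℝ} (hσ : σ ^ 2 = 1) {z : ℂ} (hz : z.im < 0) :
    DifferentiableAt ℂ (fun z : ℂ => f (z.re, σ * √(-2 * z.im))) z := by
  have hpos : 0 < -2 * z.im := by linarith
  set r := √(-2 * z.im) with hr
  have hr0 : r ≠ 0 := (Real.sqrt_pos.2 hpos).ne'
  set L := fderiv ℝ f (z.re, σ * r) with hL
  have hfL : HasFDerivAt f L (z.re, σ * r) := (hf _).hasFDerivAt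
  have ht : deriv (fun s => f (z.re, s)) (σ * r) = L (0, 1) :=
    (hfL.comp_hasDerivAt (σ * r) ((hasDerivAt_const _ _).prodMk (hasDerivAt_id _))).deriv
  have hx : deriv (fun u => f (u, σ * r)) z.re = L (1, 0) :=
    (hfL.comp_hasDerivAt z.re ((hasDerivAt_id _).prodMk (hasDerivAt_const _ _))).deriv
  have heq := hint z.re (σ * r)
  rw [ht, hx] at heq
  have hLt : L (0, 1) = -Complex.I * (σ * r) * L (1, 0) := by
    push_cast at heq
    linear_combination (-Complex.I) * heq + L (0, 1) * Complex.I_sq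
  have hs : HasFDerivAt (fun z : ℂ => σ * √(-2 * z.im))
      (σ • (1 / (2 * r)) • (-2 : ℝ) • Complex.imCLM) z :=
    ((Complex.imCLM.hasFDerivAt.const_mul (-2 : ℝ)).sqrt hpos.ne').const_mul σ
  have hcomp := hfL.comp z
    (f := fun z : ℂ => (z.re, σ * √(-2 * z.im))) (Complex.reCLM.hasFDerivAt.prodMk hs)
  refine (hasFDerivAt_of_restrictScalars ℝ hcomp
    (f' := ContinuousLinearMap.toSpanSingleton ℂ (L (1, 0))) ?_).differentiableAt
  ext v
  have hsplit (a b : ℝ) : L (a, b) = a * L (1, 0) + b * L (0, 1) := by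
    have : ((a, b) : ℝ × ℝ) = a • (1, 0) + b • (0, 1) := by simp
    rw [this, map_add, map_smul, map_smul, Complex.real_smul, Complex.real_smul]
  have hσ_sq : (σ : ℂ) ^ 2 = 1 := by exact_mod_cast hσ
  have hr_ne : (r : ℂ) ≠ 0 := by exact_mod_cast hr0
  have hv := Complex.re_add_im v
  simp only [ContinuousLinearMap.coe_restrictScalars', ContinuousLinearMap.toSpanSingleton_apply,
    ContinuousLinearMap.comp_apply, ContinuousLinearMap.prod_apply, smul_apply,
    Complex.reCLM_apply, Complex.imCLM_apply, smul_eq_mul]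
  rw [hsplit v.re (σ * _), hLt]
  push_cast
  field_simp
  linear_combination (-L (1, 0)) * hv - L (1, 0) * v.im * Complex.I * hσ_sq

/-- Any smooth integral of the Mizohata structure, i.e. a smooth `f : ℝ² → ℂ`
annihilated by `i ∂/∂t - t ∂/∂x`, is even in `t`. -/
theorem mizohata_integral_even (f : ℝ × ℝ → ℂ) (hf : ContDiff ℝ (⊤ : ℕ∞) f)
    (hint : ∀ x t : ℝ,
      Complex.I * deriv (fun s => f (x, s)) t - (t : ℂ) * deriv (fun u => f (u, t)) x = 0) :
    ∀ x t : ℝ, f (x, -t) = f (x, t) := by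
  have hd : Differentiable ℝ f := hf.differentiable (by simp)
  have hfc := hf.continuous
  have key (x t : ℝ) (ht : 0 < t) : f (x, -t) = f (x, t) := by
    have h := eq_zero_of_forall_im_eq_zero
      (h := fun z : ℂ => f (z.re, -1 * √(-2 * z.im)) - f (z.re, 1 * √(-2 * z.im)))
      (z₀ := ⟨x, -(t ^ 2 / 2)⟩) (by fun_prop)
      (fun z hz => (differentiableAt_mizohata hd hint (by norm_num) hz).sub
        (differentiableAt_mizohata hd hint (by norm_num) hz))
      (fun z hz => by simp [hz]) (by simp only; nlinarith)
    have hsq : √(-2 * -(t ^ 2 / 2)) = t := by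
      rw [show -2 * -(t ^ 2 / 2) = t ^ 2 by ring, Real.sqrt_sq ht.le]
    simp only [hsq, neg_one_mul, one_mul] at h
    exact sub_eq_zero.1 h
  intro x t
  rcases lt_trichotomy t 0 with ht | rfl | ht
  · simpa using (key x (-t) (neg_pos.2 ht)).symm
  · simp
  · exact key x t ht
end

section
/- Let ε > 0 and ζ ∈ ℂ with Im ζ < −ε. Define S = {t ∈ ℂ : |Im t| < ε and |Im(ζ + i t²/2)| < ε}. Then S is open, S contains no t with Re t = 0, and both S ∩ {t : Re t > 0} and S ∩ {t : Re t < 0} are nonempty. Consequently S is the union of two disjoint nonempty open sets, hence S is not connected. -/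
theorem mizohata_leaf_im (ζ t : ℂ) :
    (ζ + Complex.I * t ^ 2 / 2).im = ζ.im + (t.re ^ 2 - t.im ^ 2) / 2 := by
  have h : Complex.I * t ^ 2 / 2 = ((1 / 2 : ℝ) : ℂ) * (Complex.I * t ^ 2) := by
    push_cast; ring
  rw [Complex.add_im, h, Complex.im_ofReal_mul, Complex.I_mul_im, pow_two, Complex.mul_re]
  ring

/-- For `ζ` deep enough in the lower half plane, the part of the Mizohata leaf
over `ζ` lying in the strip neighborhood `{|Im t| < ε, |Im x| < ε}` has a
disconnected parameter set `S`: it is open, misses `{Re t = 0}`, and meets both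
half planes `{Re t > 0}` and `{Re t < 0}`, hence is a disjoint union of two
nonempty open sets and is not connected. -/
theorem mizohata_leaf_splits (ε : ℝ) (hε : 0 < ε) (ζ : ℂ) (hζ : ζ.im < -ε)
    (S : Set ℂ)
    (hS : S = {t : ℂ | |t.im| < ε ∧ |(ζ + Complex.I * t ^ 2 / 2).im| < ε}) :
    IsOpen S ∧
    (∀ t ∈ S, t.re ≠ 0) ∧
    (S ∩ {t : ℂ | 0 < t.re}).Nonempty ∧
    (S ∩ {t : ℂ | t.re < 0}).Nonempty ∧
    S = (S ∩ {t : ℂ | 0 < t.re}) ∪ (S ∩ {t : ℂ | t.re < 0}) ∧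
    ¬ IsPreconnected S := by
  have hre : ∀ t ∈ S, t.re ≠ 0 := by
    intro t ht h0
    rw [hS, Set.mem_ofPred_eq, mizohata_leaf_im, h0] at ht
    have h := (abs_lt.mp ht.2).1
    nlinarith [sq_nonneg t.im]
  have hmem : ∀ r : ℝ, r ^ 2 = -2 * ζ.im → (r : ℂ) ∈ S := by
    intro r hr
    rw [hS, Set.mem_ofPred_eq, mizohata_leaf_im, Complex.ofReal_re, Complex.ofReal_im, hr]
    refine ⟨by simpa using hε, ?_⟩
    have h : ζ.im + (-2 * ζ.im - 0 ^ 2) / 2 = 0 := by ring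
    rwa [h, abs_zero]
  have hpos : 0 < -2 * ζ.im := by linarith
  have hsq : √(-2 * ζ.im) ^ 2 = -2 * ζ.im := Real.sq_sqrt hpos.le
  have hright : (S ∩ {t : ℂ | 0 < t.re}).Nonempty :=
    ⟨_, hmem _ hsq, by simpa using hpos⟩
  have hleft : (S ∩ {t : ℂ | t.re < 0}).Nonempty :=
    ⟨((-√(-2 * ζ.im) : ℝ) : ℂ), hmem _ (by rw [neg_sq, hsq]), by simpa using hpos⟩
  have hcover : S ⊆ {t : ℂ | 0 < t.re} ∪ {t : ℂ | t.re < 0} :=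
    fun t ht => (hre t ht).symm.lt_or_gt
  refine ⟨?_, hre, hright, hleft, ?_, ?_⟩
  · rw [hS]
    have him : Continuous fun t : ℂ => (ζ + Complex.I * t ^ 2 / 2).im :=
      Complex.continuous_im.comp (by fun_prop)
    exact (isOpen_lt Complex.continuous_im.abs continuous_const).inter
      (isOpen_lt him.abs continuous_const)
  · rw [← Set.inter_union_distrib_left, Set.inter_eq_left.mpr hcover]
  · intro hconn
    obtain ⟨t, -, h₁, h₂⟩ := hconn _ _ (isOpen_lt continuous_const Complex.continuous_re)
      (isOpen_lt Complex.continuous_re continuous_const) hcover hright hleft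
    rw [Set.mem_ofPred_eq] at h₁ h₂
    exact lt_asymm h₁ h₂
end
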